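/- For every k ∈ ℕ there exists an n-player binary-action game with n = (2^k − 1)·2^{2^{k−1}} players and payoffs in {0,1} such that every distribution over pure action profiles that is a 1/4-coarse correlated equilibrium (in particular, every distribution that is a 1/4-correlated equilibrium) has support of size greater than (1/4)·2^k ≥ (1/4)·log₂ n. -/

import Mathlib

open Finset

/-- The number of players in the construction: `n = (2^k − 1)·2^(2^(k−1))`. -/
def numPlayers (k : ℕ) : ℕ := (2 ^ k - 1) * 2 ^ (2 ^ (k - 1))

/-- Existence of the families of transversals of the cosets of `{0, v}`. -/
lemma exists_transversals (k : ℕ) (v : Fin k → ZMod 2) (hv : v ≠ 0) :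
    ∃ A : Fin (2 ^ (2 ^ (k - 1))) → (Fin k → ZMod 2) → Bool,
      (∀ g y, A g (y + v) = !(A g y)) ∧
      ∀ Y : Finset (Fin k → ZMod 2), ∃ g, ∀ y ∈ Y, y + v ∉ Y → A g y = false := by
  classical
  cases k with
  | zero => exact absurd (Subsingleton.elim _ _) hv
  | succ m =>
    have z2 : ∀ t : ZMod 2, t = 0 ∨ t = 1 := by decide
    obtain ⟨j, hj⟩ : ∃ j, v j ≠ 0 := by
      by_contra h
      push Not at h
      exact hv (funext h)
    have hj1 : v j = 1 := (z2 _).resolve_left hj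
    have hvv : v + v = 0 := by
      funext i
      exact CharTwo.add_self_eq_zero (v i)
    have hcard : Fintype.card (Fin (2 ^ (2 ^ (m + 1 - 1)))) =
        Fintype.card ((Fin m → ZMod 2) → Bool) := by
      simp [ZMod.card]
    let e := Fintype.equivOfCardEq hcard
    let R : (Fin (m + 1) → ZMod 2) → (Fin (m + 1) → ZMod 2) :=
      fun y => if y j = 0 then y else y + v
    have hRv : ∀ y, R (y + v) = R y := by
      intro y
      simp only [R, Pi.add_apply, hj1]
      rcases z2 (y j) with h | h
      · simp [h, add_assoc, hvv]
      · have : (1 : ZMod 2) + 1 = 0 := by decide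
        simp [h, this]
    have hR0 : ∀ y, R y j = 0 := by
      intro y
      simp only [R]
      split_ifs with h
      · exact h
      · have h1 := (z2 (y j)).resolve_left h
        simp only [Pi.add_apply, hj1, h1]
        decide
    refine ⟨fun g y => xor (e g (j.removeNth (R y))) (decide (y j = 1)), ?_, ?_⟩
    · intro g y
      simp only [hRv, Pi.add_apply, hj1]
      rcases z2 (y j) with h | h
      · simp [h]
      · have : (1 : ZMod 2) + 1 = 0 := by decide
        simp [h, this]
    · intro Y
      refine ⟨e.symm (fun z => decide (j.insertNth (α := fun _ => ZMod 2) 0 z ∉ Y)), ?_⟩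
      intro y hy hyv
      have hins : j.insertNth (α := fun _ => ZMod 2) 0 (j.removeNth (R y)) = R y := by
        rw [← hR0 y]
        exact Fin.insertNth_self_removeNth j (R y)
      simp only [Equiv.apply_symm_apply, hins]
      rcases z2 (y j) with h | h
      · simp [R, h, hy]
      · simp [R, h, hyv]

/-- The label `∑ a_i v_i` of a profile. -/
def labelOf {n k : ℕ} (w : Fin n → Fin k → ZMod 2) (a : Fin n → Fin 2) : Fin k → ZMod 2 :=
  ∑ i, if a i = 1 then w i else 0

lemma labelOf_update {n k : ℕ} (w : Fin n → Fin k → ZMod 2) (a : Fin n → Fin 2) (i : Fin n) :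
    labelOf w (Function.update a i 1) = labelOf w (Function.update a i 0) + w i := by
  classical
  unfold labelOf
  rw [← Finset.add_sum_erase _ _ (Finset.mem_univ i),
    ← Finset.add_sum_erase (a := i) Finset.univ (fun j => if Function.update a i 0 j = 1 then w j else 0) (Finset.mem_univ i)]
  have : ∀ b : Fin 2, ∑ j ∈ Finset.univ.erase i, (if Function.update a i b j = 1 then w j else 0)
      = ∑ j ∈ Finset.univ.erase i, (if a j = 1 then w j else 0) := by
    intro b
    refine Finset.sum_congr rfl fun j hj => ?_
    rw [Function.update_of_ne (Finset.ne_of_mem_erase hj)]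
  rw [this, this]
  simp [add_comm]

/-- The core counting argument. -/
lemma core {n k : ℕ} (w : Fin n → Fin k → ZMod 2) (A : Fin n → (Fin k → ZMod 2) → Bool)
    (hA : ∀ i y, A i (y + w i) = !(A i y))
    (hY : ∀ v : Fin k → ZMod 2, v ≠ 0 → ∀ Y : Finset (Fin k → ZMod 2),
      ∃ i, w i = v ∧ ∀ y ∈ Y, y + v ∉ Y → A i y = false)
    (μ : (Fin n → Fin 2) → ℝ) (h0 : ∀ a, 0 ≤ μ a) (h1 : ∑ a, μ a = 1)
    (hc : ∀ i (b : Fin 2),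
      (∑ a, μ a * (if A i (labelOf w (Function.update a i b)) then (1 : ℝ) else 0)) - 1 / 4 ≤
        ∑ a, μ a * (if A i (labelOf w a) then (1 : ℝ) else 0))
    (S : Finset (Fin n → Fin 2)) (hS : ∀ a, μ a ≠ 0 ↔ a ∈ S) :
    (1 / 4 : ℝ) * 2 ^ k < S.card := by
  classical
  by_contra hlt
  push Not at hlt
  set Y := S.image (labelOf w) with hYdef
  have hYS : (Y.card : ℝ) ≤ S.card := by exact_mod_cast Finset.card_image_le
  let V := (Finset.univ : Finset (Fin k → ZMod 2)).erase 0
  have hV : (V.card : ℝ) = 2 ^ k - 1 := by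
    have : V.card = 2 ^ k - 1 := by
      simp [V, Finset.card_erase_of_mem, ZMod.card]
    rw [this, Nat.cast_sub Nat.one_le_two_pow]
    simp
  have hcnt : ∀ a ∈ S, ((V.filter fun v => labelOf w a + v ∈ Y).card : ℝ) ≤ Y.card - 1 := by
    intro a ha
    have hmem : labelOf w a ∈ Y := Finset.mem_image_of_mem _ ha
    have : (V.filter fun v => labelOf w a + v ∈ Y).card ≤ (Y.erase (labelOf w a)).card := by
      refine Finset.card_le_card_of_injOn (fun v => labelOf w a + v) ?_ ?_
      · intro v hv
        have hv' := Finset.mem_filter.1 (Finset.mem_coe.1 hv)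
        refine Finset.mem_coe.2 (Finset.mem_erase.2 ⟨?_, hv'.2⟩)
        intro h
        exact (Finset.mem_erase.1 hv'.1).1 (by simpa using h)
      · intro v _ v' _ h
        exact add_left_cancel h
    have h2 := Finset.card_erase_add_one hmem
    have h3 : (((Y.erase (labelOf w a)).card : ℝ)) + 1 = Y.card := by exact_mod_cast h2
    have h4 : ((V.filter fun v => labelOf w a + v ∈ Y).card : ℝ) ≤ (Y.erase (labelOf w a)).card := by
      exact_mod_cast this
    linarith
  have hsum : ∑ v ∈ V, ∑ a, μ a * (if labelOf w a + v ∈ Y then (1 : ℝ) else 0) ≤ Y.card - 1 := by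
    rw [Finset.sum_comm]
    calc ∑ a, ∑ v ∈ V, μ a * (if labelOf w a + v ∈ Y then (1 : ℝ) else 0)
        ≤ ∑ a, μ a * ((Y.card : ℝ) - 1) := by
          refine Finset.sum_le_sum fun a _ => ?_
          rw [← Finset.mul_sum, Finset.sum_boole]
          by_cases ha : a ∈ S
          · exact mul_le_mul_of_nonneg_left (hcnt a ha) (h0 a)
          · have : μ a = 0 := by
              by_contra h
              exact ha ((hS a).1 h)
            simp [this]
      _ = (Y.card : ℝ) - 1 := by rw [← Finset.sum_mul, h1, one_mul]
  obtain ⟨v, hvV, hv⟩ : ∃ v ∈ V,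
      ∑ a, μ a * (if labelOf w a + v ∈ Y then (1 : ℝ) else 0) < 1 / 4 := by
    refine Finset.exists_lt_of_sum_lt (lt_of_le_of_lt hsum ?_)
    rw [Finset.sum_const, nsmul_eq_mul, hV]
    linarith
  obtain ⟨i, hi, hiA⟩ := hY v (Finset.mem_erase.1 hvV).1 Y
  have hu : ∑ a, μ a * (if A i (labelOf w a) then (1 : ℝ) else 0) < 1 / 4 := by
    refine lt_of_le_of_lt (Finset.sum_le_sum fun a _ => ?_) hv
    by_cases ha : a ∈ S
    · refine mul_le_mul_of_nonneg_left ?_ (h0 a)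
      by_cases hp : labelOf w a + v ∈ Y
      · rw [if_pos hp]
        split_ifs <;> norm_num
      · rw [hiA _ (Finset.mem_image_of_mem _ ha) hp]
        simp [hp]
    · have : μ a = 0 := by
        by_contra h
        exact ha ((hS a).1 h)
      simp [this]
  have hdev : (∑ a, μ a * (if A i (labelOf w (Function.update a i 0)) then (1 : ℝ) else 0)) +
      (∑ a, μ a * (if A i (labelOf w (Function.update a i 1)) then (1 : ℝ) else 0)) = 1 := by
    rw [← Finset.sum_add_distrib]
    refine Eq.trans ?_ h1
    refine Finset.sum_congr rfl fun a _ => ?_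
    rw [labelOf_update, hA]
    cases A i (labelOf w (Function.update a i 0)) <;> simp
  have e0 := hc i 0
  have e1 := hc i 1
  linarith

lemma logb_bound (k : ℕ) : (1 / 4 : ℝ) * Real.logb 2 (numPlayers k) ≤ (1 / 4 : ℝ) * 2 ^ k := by
  refine mul_le_mul_of_nonneg_left ?_ (by norm_num)
  cases k with
  | zero => simp [numPlayers]
  | succ m =>
    have hle : numPlayers (m + 1) ≤ 2 ^ (2 ^ (m + 1)) := by
      unfold numPlayers
      have h : m + 1 ≤ 2 ^ m := Nat.lt_two_pow_self
      calc (2 ^ (m + 1) - 1) * 2 ^ (2 ^ (m + 1 - 1)) ≤ 2 ^ (2 ^ m) * 2 ^ (2 ^ m) := by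
            refine Nat.mul_le_mul ((Nat.sub_le _ _).trans ?_) (by simp)
            exact Nat.pow_le_pow_right (by norm_num) h
        _ = 2 ^ (2 ^ (m + 1)) := by rw [← pow_add]; congr 1; ring
    have hpos : 0 < numPlayers (m + 1) := by
      unfold numPlayers
      have : 1 < 2 ^ (m + 1) := Nat.one_lt_two_pow (by omega)
      exact Nat.mul_pos (by omega) (by positivity)
    have hle' : (numPlayers (m + 1) : ℝ) ≤ (2 : ℝ) ^ (2 ^ (m + 1)) := by exact_mod_cast hle
    have hpos' : (0 : ℝ) < numPlayers (m + 1) := by exact_mod_cast hpos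
    calc Real.logb 2 (numPlayers (m + 1)) ≤ Real.logb 2 ((2 : ℝ) ^ (2 ^ (m + 1))) :=
          Real.logb_le_logb_of_le (by norm_num) hpos' hle'
      _ = 2 ^ (m + 1) := by
          rw [Real.logb_pow, Real.logb_self_eq_one (by norm_num)]
          simp

/-- For every `k` there is an `n`-player binary-action game, `n = (2^k − 1)·2^(2^(k−1))`,
with payoffs in `{0,1}`, such that every distribution over pure action profiles that is a
`1/4`-coarse correlated equilibrium — and in particular every `1/4`-correlated
equilibrium — has support of size greater than `(1/4)·2^k ≥ (1/4)·log₂ n`. -/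
theorem stmt11 (k : ℕ) :
    ∃ u : Fin (numPlayers k) → ((Fin (numPlayers k) → Fin 2) → ℝ),
      (∀ i a, u i a = 0 ∨ u i a = 1) ∧
      ((1 / 4 : ℝ) * Real.logb 2 (numPlayers k) ≤ (1 / 4 : ℝ) * 2 ^ k) ∧
      (∀ μ : (Fin (numPlayers k) → Fin 2) → ℝ, (∀ a, 0 ≤ μ a) → (∑ a, μ a = 1) →
        (∀ i (b : Fin 2),
          (∑ a, μ a * u i (Function.update a i b)) - 1 / 4 ≤ ∑ a, μ a * u i a) →
        ∀ S : Finset (Fin (numPlayers k) → Fin 2), (∀ a, μ a ≠ 0 ↔ a ∈ S) →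
          (1 / 4 : ℝ) * 2 ^ k < S.card) ∧
      (∀ μ : (Fin (numPlayers k) → Fin 2) → ℝ, (∀ a, 0 ≤ μ a) → (∑ a, μ a = 1) →
        (∀ i (f : Fin 2 → Fin 2),
          (∑ a, μ a * u i (Function.update a i (f (a i)))) - 1 / 4 ≤ ∑ a, μ a * u i a) →
        ∀ S : Finset (Fin (numPlayers k) → Fin 2), (∀ a, μ a ≠ 0 ↔ a ∈ S) →
          (1 / 4 : ℝ) * 2 ^ k < S.card) := by
  classical
  choose A hA hY using exists_transversals k
  have hcard : Fintype.card (Fin (numPlayers k)) =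
      Fintype.card ({v : Fin k → ZMod 2 // v ≠ 0} × Fin (2 ^ (2 ^ (k - 1)))) := by
    rw [Fintype.card_fin]
    simp [numPlayers, Fintype.card_subtype_compl, ZMod.card]
  let e := Fintype.equivOfCardEq hcard
  let w : Fin (numPlayers k) → Fin k → ZMod 2 := fun i => (e i).1.1
  let B : Fin (numPlayers k) → (Fin k → ZMod 2) → Bool :=
    fun i => A (e i).1.1 (e i).1.2 (e i).2
  have hB : ∀ i y, B i (y + w i) = !(B i y) := fun i y => hA _ _ _ _
  have hBY : ∀ v : Fin k → ZMod 2, v ≠ 0 → ∀ Y : Finset (Fin k → ZMod 2),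
      ∃ i, w i = v ∧ ∀ y ∈ Y, y + v ∉ Y → B i y = false := by
    intro v hv Y
    obtain ⟨g, hg⟩ := hY v hv Y
    refine ⟨e.symm (⟨v, hv⟩, g), by simp [w], ?_⟩
    intro y hy hyv
    simp only [B, Equiv.apply_symm_apply]
    exact hg y hy hyv
  refine ⟨fun i a => if B i (labelOf w a) then 1 else 0, ?_, logb_bound k, ?_, ?_⟩
  · intro i a
    dsimp only
    split_ifs <;> simp
  · intro μ h0 h1 hc S hS
    exact core w B hB hBY μ h0 h1 hc S hS
  · intro μ h0 h1 hc S hS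
    exact core w B hB hBY μ h0 h1 (fun i b => hc i fun _ => b) S hS
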